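/- arXiv:1507.06720 — 2 statements merged into one kernel-verified Lean document; each statement's English description precedes it below -/
import Mathlib

section
/- Let V = ℂⁿ viewed as a real vector space, J : V → V multiplication by i, and Ω(v,w) = Im⟨v,w⟩ the associated symplectic form. Let g : V → V be an ℝ-linear automorphism with Ω(gv,gw) = Ω(v,w) for all v,w ∈ V (i.e. g ∈ Sp(V)). Define C_g = ½(g − J∘g∘J). Then C_g commutes with J (hence is a complex-linear transformation of V), and C_g is bijective (so its complex determinant is a nonzero complex number). -/
open BigOperators

/-- For V = ℂⁿ viewed as a real vector space with J = mult. by i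
and symplectic form Ω(v,w) = Im⟨v,w⟩, if g is an ℝ-linear symplectic
automorphism then C_g = ½(g − J∘g∘J) commutes with J and is bijective. -/
theorem stmt1 (n : ℕ)
    (herm : (Fin n → ℂ) → (Fin n → ℂ) → ℂ)
    (hherm : ∀ v w, herm v w = ∑ j, v j * (starRingEnd ℂ) (w j))
    (Ω : (Fin n → ℂ) → (Fin n → ℂ) → ℝ)
    (hΩ : ∀ v w, Ω v w = (herm v w).im)
    (J : (Fin n → ℂ) →ₗ[ℝ] (Fin n → ℂ))
    (hJ : ∀ v, J v = fun j => Complex.I * v j)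
    (g : (Fin n → ℂ) →ₗ[ℝ] (Fin n → ℂ))
    (hg : Function.Bijective g)
    (hsymp : ∀ v w, Ω (g v) (g w) = Ω v w)
    (C : (Fin n → ℂ) →ₗ[ℝ] (Fin n → ℂ))
    (hC : C = (1 / 2 : ℝ) • (g - J ∘ₗ g ∘ₗ J)) :
    C ∘ₗ J = J ∘ₗ C ∧ Function.Bijective C := by
  have hJJ : ∀ v, J (J v) = -v := by
    intro v
    ext j
    simp [hJ, ← mul_assoc]
  have hCv : ∀ v, C v = (1 / 2 : ℝ) • (g v - J (g (J v))) := by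
    intro v
    simp [hC]
  have hΩJ_right : ∀ v, Ω v (J v) = -∑ j, Complex.normSq (v j) := by
    intro v
    rw [hΩ, hherm, Complex.im_sum, ← Finset.sum_neg_distrib]
    refine Finset.sum_congr rfl fun j _ => ?_
    simp [hJ, Complex.normSq_apply]
  have hΩJ_left : ∀ v, Ω (J v) v = ∑ j, Complex.normSq (v j) := by
    intro v
    rw [hΩ, hherm, Complex.im_sum]
    refine Finset.sum_congr rfl fun j _ => ?_
    simp [hJ, Complex.normSq_apply]
    ring
  have hinj : Function.Injective C := by
    rw [injective_iff_map_eq_zero]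
    intro v hv
    have hgv : g v = J (g (J v)) := by
      rw [hCv, smul_eq_zero] at hv
      exact sub_eq_zero.mp (hv.resolve_left (by norm_num))
    have hsum := hsymp v (J v)
    rw [hgv, hΩJ_left, hΩJ_right] at hsum
    have hw : 0 ≤ ∑ j, Complex.normSq (g (J v) j) :=
      Finset.sum_nonneg fun j _ => Complex.normSq_nonneg _
    have hv_nonneg : 0 ≤ ∑ j, Complex.normSq (v j) :=
      Finset.sum_nonneg fun j _ => Complex.normSq_nonneg _
    have hv_zero : ∑ j, Complex.normSq (v j) = 0 := by linarith
    rw [Finset.sum_eq_zero_iff_of_nonneg fun j _ => Complex.normSq_nonneg _] at hv_zero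
    ext1 j
    exact Complex.normSq_eq_zero.mp (hv_zero j (Finset.mem_univ j))
  refine ⟨LinearMap.ext fun v => ?_, hinj, LinearMap.injective_iff_surjective.mp hinj⟩
  simp only [LinearMap.comp_apply, hCv, map_smul, map_sub, map_neg, hJJ]
  abel_nf
end

section
/- Let E be a finite-dimensional real normed vector space and let H₁, H₂ : E → ℝ be continuously differentiable functions. Let E₁, E₂ ∈ ℝ be such that the level sets coincide: S := H₁⁻¹(E₁) = H₂⁻¹(E₂), and suppose that for every s ∈ S the derivatives DH₁(s) and DH₂(s) are both nonzero (E₁ and E₂ are regular values on S). Then for every s ∈ S there exists a nonzero real number c(s) such that DH₂(s) = c(s)·DH₁(s) as linear functionals on E. -/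
/-- If two C¹ functions H₁, H₂ on a finite-dimensional real
normed space share a regular level set S = H₁⁻¹(E₁) = H₂⁻¹(E₂), then at every
point s ∈ S the derivatives are parallel: DH₂(s) = c(s)·DH₁(s) with c(s) ≠ 0. -/
theorem stmt6 (E : Type*) [NormedAddCommGroup E] [NormedSpace ℝ E]
    [FiniteDimensional ℝ E]
    (H₁ H₂ : E → ℝ)
    (hH₁ : ContDiff ℝ 1 H₁) (hH₂ : ContDiff ℝ 1 H₂)
    (E₁ E₂ : ℝ)
    (hS : H₁ ⁻¹' {E₁} = H₂ ⁻¹' {E₂})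
    (hreg : ∀ s ∈ H₁ ⁻¹' {E₁}, fderiv ℝ H₁ s ≠ 0 ∧ fderiv ℝ H₂ s ≠ 0) :
    ∀ s ∈ H₁ ⁻¹' {E₁}, ∃ c : ℝ, c ≠ 0 ∧ fderiv ℝ H₂ s = c • fderiv ℝ H₁ s := by
  intro s hs
  have := FiniteDimensional.complete ℝ E
  obtain ⟨h₁, h₂⟩ := hreg s hs
  have hextr : IsLocalExtrOn H₂ {x | H₁ x = H₁ s} s := by
    refine Or.inl (Filter.eventually_of_mem self_mem_nhdsWithin fun x hx => ?_)
    have hx' : x ∈ H₂ ⁻¹' {E₂} := hS ▸ (Eq.trans hx hs : H₁ x = E₁)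
    have hs' : s ∈ H₂ ⁻¹' {E₂} := hS ▸ hs
    exact (Eq.trans hs' (Eq.symm hx') : H₂ s = H₂ x).le
  obtain ⟨a, b, hab, h⟩ := hextr.exists_multipliers_of_hasStrictFDerivAt_1d
    (hH₁.contDiffAt.hasStrictFDerivAt one_ne_zero) (hH₂.contDiffAt.hasStrictFDerivAt one_ne_zero)
  have hb : b ≠ 0 := by
    rintro rfl
    simp_all
  have hc : fderiv ℝ H₂ s = (-(b⁻¹ * a)) • fderiv ℝ H₁ s := by
    rw [neg_smul, mul_smul, eq_neg_of_add_eq_zero_left h, smul_neg, neg_neg, inv_smul_smul₀ hb]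
  refine ⟨_, fun h0 => h₂ ?_, hc⟩
  rw [hc, h0, zero_smul]
end
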